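/- Suppose (A1), (A2) and (sub2) hold. Let α ∈ (0,π] and w = π/(2α). Then there exist A ∈ (0,∞) and ε₁, ε₂ > 0 such that for all x ∈ W(α) with ‖x‖ > A, P[τ_{α,A} > ε₁‖x‖² | ξ₀ = x] ≥ ε₂ cos(wφ(x)), where φ(x) ∈ (−π,π] is the polar angle of x. -/

import Mathlib

open MeasureTheory
open scoped ENNReal

noncomputable section

/-- Euclidean norm of a lattice point in `ℤ²`. -/
def znorm (x : ℤ × ℤ) : ℝ := Real.sqrt ((x.1 : ℝ) ^ 2 + (x.2 : ℝ) ^ 2)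

/-- Polar angle in `(-π, π]` of a lattice point. -/
def ang (x : ℤ × ℤ) : ℝ := Complex.arg ⟨(x.1 : ℝ), (x.2 : ℝ)⟩

/-- The harmonic function `f_w(x) = r^w cos(w φ)` in polar coordinates. -/
def fw (w : ℝ) (x : ℤ × ℤ) : ℝ := znorm x ^ w * Real.cos (w * ang x)

/-- First component of the mean drift at `x` given jump pmf `p`. -/
def mu1 (p : ℤ × ℤ → ℤ × ℤ → ℝ) (x : ℤ × ℤ) : ℝ := ∑' y : ℤ × ℤ, p x y * (y.1 : ℝ)

/-- Second component of the mean drift at `x`. -/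
def mu2 (p : ℤ × ℤ → ℤ × ℤ → ℝ) (x : ℤ × ℤ) : ℝ := ∑' y : ℤ × ℤ, p x y * (y.2 : ℝ)

/-- Euclidean norm of the mean drift at `x`. -/
def muNorm (p : ℤ × ℤ → ℤ × ℤ → ℝ) (x : ℤ × ℤ) : ℝ :=
  Real.sqrt (mu1 p x ^ 2 + mu2 p x ^ 2)

/-- Second moment `M₁₁(x)`. -/
def M11 (p : ℤ × ℤ → ℤ × ℤ → ℝ) (x : ℤ × ℤ) : ℝ := ∑' y : ℤ × ℤ, p x y * (y.1 : ℝ) ^ 2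

/-- Second moment `M₂₂(x)`. -/
def M22 (p : ℤ × ℤ → ℤ × ℤ → ℝ) (x : ℤ × ℤ) : ℝ := ∑' y : ℤ × ℤ, p x y * (y.2 : ℝ) ^ 2

/-- Mixed second moment `M₁₂(x)`. -/
def M12 (p : ℤ × ℤ → ℤ × ℤ → ℝ) (x : ℤ × ℤ) : ℝ :=
  ∑' y : ℤ × ℤ, p x y * ((y.1 : ℝ) * (y.2 : ℝ))

/-- `p` is a family of probability mass functions on `ℤ²` (the jump laws `θ(x)`). -/
def IsJumpPMF (p : ℤ × ℤ → ℤ × ℤ → ℝ) : Prop :=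
  (∀ x y, 0 ≤ p x y) ∧ ∀ x, HasSum (p x) 1

/-- (A2): jumps are uniformly bounded by `b`: `P[‖θ(x)‖ > b] = 0` for all `x`. -/
def A2 (p : ℤ × ℤ → ℤ × ℤ → ℝ) (b : ℝ) : Prop :=
  ∀ x y, b < znorm y → p x y = 0

section walk

variable {Ω : Type*} [MeasurableSpace Ω]

/-- `ξ` is a time-homogeneous Markov chain with one-step jump law `p`:
conditionally on the past and on `ξ_t = x`, the law of `ξ_{t+1} - ξ_t` is `p x`. -/
def IsMarkovWith (P : Measure Ω) (ξ : ℕ → Ω → ℤ × ℤ) (p : ℤ × ℤ → ℤ × ℤ → ℝ) : Prop :=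
  ∀ (t : ℕ) (x y : ℤ × ℤ) (A : Set Ω),
    MeasurableSet[⨆ s ∈ Finset.range (t + 1), MeasurableSpace.comap (ξ s) ⊤] A →
    P (A ∩ {ω | ξ t ω = x} ∩ {ω | ξ (t + 1) ω = x + y}) =
      ENNReal.ofReal (p x y) * P (A ∩ {ω | ξ t ω = x})

/-- (A1): uniform weak isotropy: from any `x ∈ S`, in `n₀` steps the walk moves by
each of `±k e₁, ±k e₂` with conditional probability at least `κ`. -/
def A1 (P : Measure Ω) (S : Set (ℤ × ℤ)) (ξ : ℕ → Ω → ℤ × ℤ)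
    (κ : ℝ) (k n₀ : ℕ) : Prop :=
  ∀ (t : ℕ), ∀ x ∈ S,
    ∀ y ∈ ({((k : ℤ), (0 : ℤ)), (-(k : ℤ), 0), (0, (k : ℤ)), (0, -(k : ℤ))} : Set (ℤ × ℤ)),
      ENNReal.ofReal κ * P {ω | ξ t ω = x} ≤
        P ({ω | ξ t ω = x} ∩ {ω | ξ (t + n₀) ω = x + y})

/-- First exit time from a region `Wm`, with value `∞` if the walk never leaves. -/
def exitTime (Wm : Set (ℤ × ℤ)) (ξ : ℕ → Ω → ℤ × ℤ) (ω : Ω) : ℝ≥0∞ :=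
  ⨅ (t : ℕ) (_ : ξ t ω ∉ Wm), (t : ℝ≥0∞)

end walk

/-- The wedge `W(α)` for `α ∈ (0,π)`, together with the `α = π` case, where
`W(π) = ℝ² \ H_b` is the complement of the thickened half-line of half-width `b`. -/
def Wset (b α : ℝ) : Set (ℤ × ℤ) :=
  {x | (α < Real.pi ∧ znorm x * Real.cos α < (x.1 : ℝ)) ∨
       (α = Real.pi ∧ ¬ ((x.1 : ℝ) ≤ 0 ∧ |(x.2 : ℝ)| ≤ b))}

/-- The wedge `W(α) = {x : r > 0, -α < φ < α}` in polar form, for `α ∈ (0,π]`. -/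
def WsetArg (α : ℝ) : Set (ℤ × ℤ) :=
  {x | 0 < znorm x ∧ -α < ang x ∧ ang x < α}

end

/-- The value at `y` of the linear functional with coefficients `n`. -/
noncomputable def lin (n : ℝ × ℝ) (y : ℤ × ℤ) : ℝ := n.1 * y.1 + n.2 * y.2

/-- The part of the half-plane `{lin n > 0}` within distance `δ ‖x‖` of `x`. -/
noncomputable def halfBall (n : ℝ × ℝ) (x : ℤ × ℤ) (δ : ℝ) : Set (ℤ × ℤ) :=
  {y | 0 < lin n y ∧ znorm (y - x) < δ * znorm x}

/-- A cubic polynomial, nonpositive upon exit from `halfBall n x δ`, which is a submartingale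
along the walk when `c` grows linearly in time. -/
noncomputable def barrier (n : ℝ × ℝ) (x : ℤ × ℤ) (b δ c : ℝ) (y : ℤ × ℤ) : ℝ :=
  c * (lin n y + lin n y ^ 2 / znorm x) -
    6 * (lin n y + b) * (znorm (y - x) / (δ * znorm x)) ^ 2

lemma lin_add (n : ℝ × ℝ) (y z : ℤ × ℤ) : lin n (y + z) = lin n y + lin n z := by
  simp only [lin, Prod.fst_add, Prod.snd_add]; push_cast; ring

lemma lin_sub (n : ℝ × ℝ) (y z : ℤ × ℤ) : lin n (y - z) = lin n y - lin n z := by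
  simp only [lin, Prod.fst_sub, Prod.snd_sub]; push_cast; ring

lemma znorm_nonneg (x : ℤ × ℤ) : 0 ≤ znorm x := Real.sqrt_nonneg _

lemma znorm_sq (x : ℤ × ℤ) : znorm x ^ 2 = (x.1 : ℝ) ^ 2 + (x.2 : ℝ) ^ 2 :=
  Real.sq_sqrt (by positivity)

lemma znorm_eq_norm (x : ℤ × ℤ) : znorm x = ‖(⟨x.1, x.2⟩ : ℂ)‖ := by
  rw [Complex.norm_eq_sqrt_sq_add_sq, znorm]

lemma znorm_add_le (x y : ℤ × ℤ) : znorm (x + y) ≤ znorm x + znorm y := by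
  simp only [znorm_eq_norm]
  refine le_trans (le_of_eq ?_) (norm_add_le _ _)
  congr 1
  apply Complex.ext <;> simp

lemma znorm_sub_comm (x y : ℤ × ℤ) : znorm (x - y) = znorm (y - x) := by
  simp only [znorm, Prod.fst_sub, Prod.snd_sub]
  congr 1; push_cast; ring

lemma abs_mul_add_mul_le {a b c d u v : ℝ} (hu : 0 ≤ u) (hv : 0 ≤ v)
    (h₁ : a ^ 2 + b ^ 2 ≤ u ^ 2) (h₂ : c ^ 2 + d ^ 2 ≤ v ^ 2) : |a * c + b * d| ≤ u * v := by
  refine abs_le_of_sq_le_sq ?_ (mul_nonneg hu hv)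
  nlinarith [sq_nonneg (a * d - b * c), mul_le_mul h₁ h₂ (by positivity) (by positivity)]

lemma abs_lin_le {n : ℝ × ℝ} (hn : n.1 ^ 2 + n.2 ^ 2 = 1) (y : ℤ × ℤ) :
    |lin n y| ≤ znorm y := by
  have := abs_mul_add_mul_le zero_le_one (znorm_nonneg y) (a := n.1) (b := n.2)
    (by rw [hn]; norm_num) (znorm_sq y).ge
  simpa [lin] using this

lemma finite_znorm_le (r : ℝ) : {y : ℤ × ℤ | znorm y ≤ r}.Finite := by
  refine (Set.finite_Icc ((-⌈r⌉, -⌈r⌉) : ℤ × ℤ) (⌈r⌉, ⌈r⌉)).subset fun y hy => ?_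
  have hy : znorm y ≤ r := hy
  have hc := Int.le_ceil r
  have h1 : |(y.1 : ℝ)| ≤ znorm y := Real.abs_le_sqrt (by nlinarith [sq_nonneg (y.2 : ℝ)])
  have h2 : |(y.2 : ℝ)| ≤ znorm y := Real.abs_le_sqrt (by nlinarith [sq_nonneg (y.1 : ℝ)])
  rw [abs_le] at h1 h2
  refine ⟨⟨?_, ?_⟩, ?_, ?_⟩ <;> simp only <;> rify <;> linarith

lemma znorm_le_of_sub_le {x y : ℤ × ℤ} {r : ℝ} (h : znorm (y - x) ≤ r) :
    znorm y ≤ znorm x + r := by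
  have := znorm_add_le x (y - x)
  rw [add_sub_cancel] at this
  linarith

lemma finite_halfBall (n : ℝ × ℝ) (x : ℤ × ℤ) (δ : ℝ) : (halfBall n x δ).Finite :=
  (finite_znorm_le (znorm x + δ * znorm x)).subset fun _ hy => znorm_le_of_sub_le hy.2.le

lemma barrier_le {n : ℝ × ℝ} (hn : n.1 ^ 2 + n.2 ^ 2 = 1) {x : ℤ × ℤ} (hx : 0 < znorm x)
    {b δ c : ℝ} (hb : 0 < b) (hδ : δ ≤ 1 / 2) (hc0 : 0 ≤ c) (hc : c ≤ 2) {y : ℤ × ℤ}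
    (hy : y ∈ halfBall n x δ) : barrier n x b δ c y ≤ 12 * znorm x := by
  obtain ⟨hl, hd⟩ := hy
  have h1 : lin n y ≤ 2 * znorm x := by
    have := (abs_le.1 (abs_lin_le hn y)).2
    have := znorm_le_of_sub_le hd.le
    nlinarith
  have h2 : lin n y ^ 2 / znorm x ≤ 4 * znorm x := by
    rw [div_le_iff₀ hx]; nlinarith
  have h3 : 0 ≤ 6 * (lin n y + b) * (znorm (y - x) / (δ * znorm x)) ^ 2 := by positivity
  have h4 : 0 ≤ lin n y ^ 2 / znorm x := by positivity
  unfold barrier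
  nlinarith

lemma barrier_nonpos_of_exit {n : ℝ × ℝ} (hn : n.1 ^ 2 + n.2 ^ 2 = 1) {x : ℤ × ℤ}
    {b δ c : ℝ} (hb : 0 < b) (hx : 2 * b ≤ znorm x) (hδ0 : 0 < δ) (hδ : δ ≤ 1 / 2)
    (hc0 : 0 ≤ c) (hc : c ≤ 2) {y θ : ℤ × ℤ} (hy : y ∈ halfBall n x δ) (hθ : znorm θ ≤ b)
    (hout : y + θ ∉ halfBall n x δ) : barrier n x b δ c (y + θ) ≤ 0 := by
  obtain ⟨hl, hd⟩ := hy
  have hR : 0 < znorm x := by linarith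
  have hlθ := abs_le.1 (abs_lin_le hn θ)
  have hadd := lin_add n y θ
  have h1 : lin n (y + θ) ≤ 2 * znorm x := by
    have := (abs_le.1 (abs_lin_le hn y)).2
    have := znorm_le_of_sub_le hd.le
    nlinarith
  have h0 : -b ≤ lin n (y + θ) := by linarith
  unfold barrier
  set l := lin n (y + θ)
  have hfac : l + l ^ 2 / znorm x = l * (1 + l / znorm x) := by field_simp
  have hge : 0 ≤ 1 + l / znorm x := by
    have : -1 ≤ l / znorm x := by rw [le_div_iff₀ hR]; linarith
    linarith
  have hle : 1 + l / znorm x ≤ 3 := by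
    have : l / znorm x ≤ 2 := by rw [div_le_iff₀ hR]; linarith
    linarith
  rw [hfac]
  rcases le_or_gt l 0 with hneg | hpos
  · have : 0 ≤ 6 * (l + b) * (znorm (y + θ - x) / (δ * znorm x)) ^ 2 :=
      mul_nonneg (by linarith) (sq_nonneg _)
    nlinarith [mul_nonneg hc0 (mul_nonneg (neg_nonneg.2 hneg) hge)]
  · have hfar : δ * znorm x ≤ znorm (y + θ - x) := by
      by_contra! h; exact hout ⟨hpos, h⟩
    have h5 : 1 ≤ (znorm (y + θ - x) / (δ * znorm x)) ^ 2 :=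
      one_le_pow₀ ((one_le_div (by positivity)).2 hfar)
    have h6 : c * (l * (1 + l / znorm x)) ≤ 2 * (l * 3) :=
      mul_le_mul hc (mul_le_mul_of_nonneg_left hle hpos.le) (by positivity) (by norm_num)
    nlinarith

lemma le_barrier_self (n : ℝ × ℝ) (x : ℤ × ℤ) (b δ : ℝ) :
    lin n x ≤ barrier n x b δ 1 x := by
  have : 0 ≤ lin n x ^ 2 / znorm x := div_nonneg (sq_nonneg _) (znorm_nonneg x)
  have h0 : znorm (x - x) = 0 := by simp [znorm]
  unfold barrier
  rw [h0]
  simpa using this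

lemma sum_mul_cubic (B : Finset (ℤ × ℤ)) (q f : ℤ × ℤ → ℝ) (a a1 a2 a11 a12 a22 a3 : ℝ) :
    ∑ θ ∈ B, q θ * (a + a1 * θ.1 + a2 * θ.2 + a11 * θ.1 ^ 2 + a12 * (θ.1 * θ.2)
      + a22 * θ.2 ^ 2 + a3 * f θ) =
    a * ∑ θ ∈ B, q θ + a1 * ∑ θ ∈ B, q θ * θ.1 + a2 * ∑ θ ∈ B, q θ * θ.2
      + a11 * ∑ θ ∈ B, q θ * (θ.1 : ℝ) ^ 2 + a12 * ∑ θ ∈ B, q θ * ((θ.1 : ℝ) * θ.2)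
      + a22 * ∑ θ ∈ B, q θ * (θ.2 : ℝ) ^ 2 + a3 * ∑ θ ∈ B, q θ * f θ := by
  simp only [Finset.mul_sum, ← Finset.sum_add_distrib]
  exact Finset.sum_congr rfl fun θ _ => by ring

lemma quad_form_ge {n₁ n₂ m₁₁ m₁₂ m₂₂ s ε : ℝ} (hn : n₁ ^ 2 + n₂ ^ 2 = 1)
    (h₁₁ : |m₁₁ - s| ≤ ε) (h₂₂ : |m₂₂ - s| ≤ ε) (h₁₂ : |m₁₂| ≤ ε) :
    s - 2 * ε ≤ n₁ ^ 2 * m₁₁ + 2 * (n₁ * n₂) * m₁₂ + n₂ ^ 2 * m₂₂ := by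
  rw [abs_le] at *
  have t1 := mul_nonneg (sq_nonneg (n₁ + n₂)) (by linarith : 0 ≤ m₁₂ + ε)
  have t2 := mul_nonneg (sq_nonneg (n₁ - n₂)) (by linarith : 0 ≤ ε - m₁₂)
  have t3 := mul_nonneg (sq_nonneg n₁) (by linarith : 0 ≤ m₁₁ - s + ε)
  have t4 := mul_nonneg (sq_nonneg n₂) (by linarith : 0 ≤ m₂₂ - s + ε)
  linear_combination (t1 + t2) / 2 + t3 + t4 + (2 * ε - s) * hn

lemma bilin_form_le {n₁ n₂ v₁ v₂ m₁₁ m₁₂ m₂₂ s ε r : ℝ} (hn : n₁ ^ 2 + n₂ ^ 2 = 1)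
    (hr : 0 ≤ r) (hv : v₁ ^ 2 + v₂ ^ 2 ≤ r ^ 2)
    (h₁₁ : |m₁₁ - s| ≤ ε) (h₂₂ : |m₂₂ - s| ≤ ε) (h₁₂ : |m₁₂| ≤ ε) :
    v₁ * n₁ * m₁₁ + (v₁ * n₂ + v₂ * n₁) * m₁₂ + v₂ * n₂ * m₂₂ ≤
      s * (n₁ * v₁ + n₂ * v₂) + 4 * ε * r := by
  have hn₁ : |n₁| ≤ 1 := abs_le_of_sq_le_sq (by nlinarith [sq_nonneg n₂]) zero_le_one
  have hn₂ : |n₂| ≤ 1 := abs_le_of_sq_le_sq (by nlinarith [sq_nonneg n₁]) zero_le_one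
  have hv₁ : |v₁| ≤ r := abs_le_of_sq_le_sq (by nlinarith [sq_nonneg v₂]) hr
  have hv₂ : |v₂| ≤ r := abs_le_of_sq_le_sq (by nlinarith [sq_nonneg v₁]) hr
  have key : ∀ {v n m : ℝ}, |v| ≤ r → |n| ≤ 1 → |m| ≤ ε → v * n * m ≤ r * 1 * ε :=
    fun hv hn hm => (le_abs_self _).trans <| by
      rw [abs_mul, abs_mul]
      gcongr
  have := key hv₁ hn₁ h₁₁
  have := key hv₁ hn₂ h₁₂
  have := key hv₂ hn₁ h₁₂
  have := key hv₂ hn₂ h₂₂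
  linarith

lemma sum_mul_lin_mul_sq_le {n : ℝ × ℝ} (hn : n.1 ^ 2 + n.2 ^ 2 = 1) {b : ℝ} (hb : 0 < b)
    (B : Finset (ℤ × ℤ)) {q : ℤ × ℤ → ℝ} (hq : ∀ θ, 0 ≤ q θ) (hsum : ∑ θ ∈ B, q θ = 1)
    (hsupp : ∀ θ, b < znorm θ → q θ = 0) :
    ∑ θ ∈ B, q θ * (lin n θ * znorm θ ^ 2) ≤ b ^ 3 := by
  calc ∑ θ ∈ B, q θ * (lin n θ * znorm θ ^ 2) ≤ ∑ θ ∈ B, q θ * b ^ 3 := by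
        refine Finset.sum_le_sum fun θ _ => ?_
        rcases lt_or_ge b (znorm θ) with h | h
        · simp [hsupp θ h]
        · have h1 : lin n θ ≤ b := ((le_abs_self _).trans (abs_lin_le hn θ)).trans h
          have h2 := znorm_nonneg θ
          refine mul_le_mul_of_nonneg_left ?_ (hq θ)
          calc lin n θ * znorm θ ^ 2 ≤ b * b ^ 2 := by gcongr
            _ = b ^ 3 := by ring
    _ = b ^ 3 := by rw [← Finset.sum_mul, hsum, one_mul]

/-- The mean of the barrier after one step. -/
lemma sum_mul_barrier (n : ℝ × ℝ) (x y : ℤ × ℤ) (b δ c : ℝ) (B : Finset (ℤ × ℤ))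
    {q : ℤ × ℤ → ℝ} (hsum : ∑ θ ∈ B, q θ = 1) {m₁ m₂ m₁₁ m₁₂ m₂₂ e : ℝ}
    (h₁ : ∑ θ ∈ B, q θ * θ.1 = m₁) (h₂ : ∑ θ ∈ B, q θ * θ.2 = m₂)
    (h₁₁ : ∑ θ ∈ B, q θ * (θ.1 : ℝ) ^ 2 = m₁₁)
    (h₁₂ : ∑ θ ∈ B, q θ * ((θ.1 : ℝ) * θ.2) = m₁₂)
    (h₂₂ : ∑ θ ∈ B, q θ * (θ.2 : ℝ) ^ 2 = m₂₂)
    (he : ∑ θ ∈ B, q θ * (lin n θ * znorm θ ^ 2) = e) :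
    ∑ θ ∈ B, q θ * barrier n x b δ c (y + θ) =
      c * (lin n y + lin n y ^ 2 / znorm x
        + ((n.1 * m₁ + n.2 * m₂) + (2 * lin n y * (n.1 * m₁ + n.2 * m₂)
          + (n.1 ^ 2 * m₁₁ + 2 * (n.1 * n.2) * m₁₂ + n.2 ^ 2 * m₂₂)) / znorm x))
      - 6 / (δ * znorm x) ^ 2 * ((lin n y + b) * znorm (y - x) ^ 2
        + ((lin n y + b) * (2 * ((y - x).1 * m₁ + (y - x).2 * m₂) + (m₁₁ + m₂₂))
          + (n.1 * m₁ + n.2 * m₂) * znorm (y - x) ^ 2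
          + 2 * ((y - x).1 * n.1 * m₁₁ + ((y - x).1 * n.2 + (y - x).2 * n.1) * m₁₂
            + (y - x).2 * n.2 * m₂₂) + e)) := by
  set l := lin n y
  set k := 6 / (δ * znorm x) ^ 2
  set v₁ : ℝ := ((y - x).1 : ℝ) with hv₁
  set v₂ : ℝ := ((y - x).2 : ℝ) with hv₂
  have key := sum_mul_cubic B q (fun θ => lin n θ * znorm θ ^ 2)
    (c * (l + l ^ 2 / znorm x) - k * ((l + b) * (v₁ ^ 2 + v₂ ^ 2)))
    (c * (n.1 + 2 * l * n.1 / znorm x) - k * ((l + b) * (2 * v₁) + n.1 * (v₁ ^ 2 + v₂ ^ 2)))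
    (c * (n.2 + 2 * l * n.2 / znorm x) - k * ((l + b) * (2 * v₂) + n.2 * (v₁ ^ 2 + v₂ ^ 2)))
    (c * (n.1 ^ 2 / znorm x) - k * ((l + b) + 2 * (v₁ * n.1)))
    (c * (2 * (n.1 * n.2) / znorm x) - k * (2 * (v₁ * n.2 + v₂ * n.1)))
    (c * (n.2 ^ 2 / znorm x) - k * ((l + b) + 2 * (v₂ * n.2))) (-k)
  rw [hsum, h₁, h₂, h₁₁, h₁₂, h₂₂, he] at key
  rw [znorm_sq, ← hv₁, ← hv₂]
  convert key using 1
  · refine Finset.sum_congr rfl fun θ _ => ?_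
    congr 1
    have e1 : znorm (y + θ - x) ^ 2 = (v₁ + θ.1) ^ 2 + (v₂ + θ.2) ^ 2 := by
      rw [znorm_sq, hv₁, hv₂]
      simp only [Prod.fst_add, Prod.snd_add, Prod.fst_sub, Prod.snd_sub]
      push_cast
      ring
    have e2 : lin n θ = n.1 * θ.1 + n.2 * θ.2 := rfl
    rw [barrier, div_pow, e1, lin_add, znorm_sq, e2]
    change c * (l + _ + _) - _ = _
    ring
  · ring

/-- The drift of the barrier, in terms of the first and second moments of a jump. -/
lemma barrier_drift_ineq {n₁ n₂ v₁ v₂ m₁ m₂ m₁₁ m₁₂ m₂₂ e l l₀ R V b δ c s ε : ℝ}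
    (hn : n₁ ^ 2 + n₂ ^ 2 = 1)
    (hb : 0 < b) (hx : 0 < R) (hδ0 : 0 < δ) (hδ : δ ≤ 1 / 2)
    (hs : 0 < s) (hε : 0 < ε) (hεs : 24 * ε + 48 * ε / δ ≤ s / 2)
    (hxs : 6 / δ ^ 2 * (b * (2 * s + 4 * ε) + b ^ 3) ≤ s / 2 * R)
    (hc : 1 ≤ c) (hnx : 0 < l₀) (hl : 0 < l) (hlR : l ≤ 2 * R)
    (hlv : n₁ * v₁ + n₂ * v₂ = l - l₀) (hVv : V = v₁ ^ 2 + v₂ ^ 2) (hV : V ≤ (δ * R) ^ 2)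
    (hμ : m₁ ^ 2 + m₂ ^ 2 ≤ (2 * ε / R) ^ 2)
    (h₁₁ : |m₁₁ - s| ≤ ε) (h₂₂ : |m₂₂ - s| ≤ ε) (h₁₂ : |m₁₂| ≤ ε) (he : e ≤ b ^ 3) :
    c * (l + l ^ 2 / R) - 6 / (δ * R) ^ 2 * ((l + b) * V) ≤
      (c + 24 * (s + ε) / δ ^ 2 / R ^ 2) * (l + l ^ 2 / R
        + ((n₁ * m₁ + n₂ * m₂) + (2 * l * (n₁ * m₁ + n₂ * m₂)
          + (n₁ ^ 2 * m₁₁ + 2 * (n₁ * n₂) * m₁₂ + n₂ ^ 2 * m₂₂)) / R))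
      - 6 / (δ * R) ^ 2 * ((l + b) * V
        + ((l + b) * (2 * (v₁ * m₁ + v₂ * m₂) + (m₁₁ + m₂₂))
          + (n₁ * m₁ + n₂ * m₂) * V
          + 2 * (v₁ * n₁ * m₁₁ + (v₁ * n₂ + v₂ * n₁) * m₁₂
            + v₂ * n₂ * m₂₂) + e)) := by
  have hv : v₁ ^ 2 + v₂ ^ 2 ≤ (δ * R) ^ 2 := hVv ▸ hV
  set N := n₁ * m₁ + n₂ * m₂
  set Q := n₁ ^ 2 * m₁₁ + 2 * (n₁ * n₂) * m₁₂ + n₂ ^ 2 * m₂₂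
  have hV0 : 0 ≤ V := hVv ▸ by positivity
  have hN : |N| ≤ 1 * (2 * ε / R) :=
    abs_mul_add_mul_le zero_le_one (by positivity) (by rw [hn]; norm_num) hμ
  have hvμ : |v₁ * m₁ + v₂ * m₂| ≤ δ * R * (2 * ε / R) :=
    abs_mul_add_mul_le (by positivity) (by positivity) hv hμ
  have hvμ' : v₁ * m₁ + v₂ * m₂ ≤ ε := by
    refine (le_abs_self _).trans (hvμ.trans ?_)
    have : δ * R * (2 * ε / R) = 2 * δ * ε := by field_simp
    nlinarith
  rw [one_mul, abs_le] at hN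
  have hQ : s - 2 * ε ≤ Q := quad_form_ge hn h₁₁ h₂₂ h₁₂
  have hbil := bilin_form_le hn (by positivity : 0 ≤ δ * R) hv h₁₁ h₂₂ h₁₂
  rw [abs_le] at h₁₁ h₂₂
  have hDh : (s - 12 * ε) / R ≤ N + (2 * l * N + Q) / R := by
    have h3 : 2 * l * (N + 2 * ε / R) ≥ 0 := mul_nonneg (by linarith) (by linarith)
    have h4 : 2 * l * (2 * ε / R) ≤ 8 * ε := by
      have : 2 * l * (2 * ε / R) = 4 * ε * l / R := by ring
      rw [this, div_le_iff₀ hx]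
      nlinarith
    have h5 : (s - 10 * ε) / R ≤ (2 * l * N + Q) / R := by gcongr; linarith
    have h6 : (s - 12 * ε) / R = (s - 10 * ε) / R - 2 * ε / R := by ring
    linarith
  have hDq : (l + b) * (2 * (v₁ * m₁ + v₂ * m₂) + (m₁₁ + m₂₂)) + N * V
      + 2 * (v₁ * n₁ * m₁₁ + (v₁ * n₂ + v₂ * n₁) * m₁₂ + v₂ * n₂ * m₂₂) + e ≤
      (l + b) * (2 * s + 4 * ε) + 2 * ε / R * (δ * R) ^ 2
        + 2 * (s * l + 4 * ε * (δ * R)) + b ^ 3 := by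
    have h1 : (l + b) * (2 * (v₁ * m₁ + v₂ * m₂) + (m₁₁ + m₂₂)) ≤ (l + b) * (2 * s + 4 * ε) :=
      mul_le_mul_of_nonneg_left (by linarith) (by linarith)
    have h2 : N * V ≤ 2 * ε / R * (δ * R) ^ 2 := mul_le_mul hN.2 hV hV0 (by positivity)
    have h3 : s * (n₁ * v₁ + n₂ * v₂) ≤ s * l := by
      rw [hlv]; exact mul_le_mul_of_nonneg_left (by linarith) hs.le
    linarith
  set Dh := N + (2 * l * N + Q) / R
  have hkDq := mul_le_mul_of_nonneg_left hDq (by positivity : 0 ≤ 6 / (δ * R) ^ 2)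
  have hk : 6 / (δ * R) ^ 2 * ((l + b) * (2 * s + 4 * ε) + 2 * ε / R * (δ * R) ^ 2
        + 2 * (s * l + 4 * ε * (δ * R)) + b ^ 3) =
      24 * (s + ε) / δ ^ 2 / R ^ 2 * l
        + 6 / δ ^ 2 * (b * (2 * s + 4 * ε) + b ^ 3) / R ^ 2 + (12 * ε + 48 * ε / δ) / R := by
    field_simp
    ring
  have hb1 : 6 / δ ^ 2 * (b * (2 * s + 4 * ε) + b ^ 3) / R ^ 2 ≤ s / 2 / R := by
    rw [div_le_iff₀ (by positivity)]
    refine hxs.trans (le_of_eq ?_)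
    field_simp
  have hb2 : (12 * ε + 48 * ε / δ) / R ≤ (s / 2 - 12 * ε) / R := by gcongr; linarith
  have hb3 : (s - 12 * ε) / R = s / 2 / R + (s / 2 - 12 * ε) / R := by ring
  have hDh0 : 0 ≤ Dh := by
    refine le_trans (div_nonneg ?_ hx.le) hDh
    have : 0 ≤ 48 * ε / δ := by positivity
    linarith
  set γ := 24 * (s + ε) / δ ^ 2 / R ^ 2
  have hγ : 0 ≤ γ := by positivity
  have hh : 0 ≤ l ^ 2 / R := by positivity
  have hfin : Dh + γ * l ≤ (c + γ) * (l + l ^ 2 / R + Dh) - c * (l + l ^ 2 / R) := by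
    linear_combination mul_nonneg hγ hh + mul_nonneg hγ hDh0 + mul_nonneg (sub_nonneg.2 hc) hDh0
  rw [mul_add (6 / (δ * R) ^ 2)]
  linarith

lemma barrier_le_sum {n : ℝ × ℝ} (hn : n.1 ^ 2 + n.2 ^ 2 = 1) {x y : ℤ × ℤ}
    {b δ c s ε : ℝ} (hb : 0 < b) (hx : 0 < znorm x) (hδ0 : 0 < δ) (hδ : δ ≤ 1 / 2)
    (hs : 0 < s) (hε : 0 < ε) (hεs : 24 * ε + 48 * ε / δ ≤ s / 2)
    (hxs : 6 / δ ^ 2 * (b * (2 * s + 4 * ε) + b ^ 3) ≤ s / 2 * znorm x)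
    (hc : 1 ≤ c) (hnx : 0 < lin n x) (hy : y ∈ halfBall n x δ) (B : Finset (ℤ × ℤ))
    {q : ℤ × ℤ → ℝ} (hq : ∀ θ, 0 ≤ q θ) (hsum : ∑ θ ∈ B, q θ = 1)
    (hsupp : ∀ θ, b < znorm θ → q θ = 0)
    (hμ : (∑ θ ∈ B, q θ * θ.1) ^ 2 + (∑ θ ∈ B, q θ * θ.2) ^ 2 ≤ (2 * ε / znorm x) ^ 2)
    (h₁₁ : |∑ θ ∈ B, q θ * (θ.1 : ℝ) ^ 2 - s| ≤ ε)
    (h₂₂ : |∑ θ ∈ B, q θ * (θ.2 : ℝ) ^ 2 - s| ≤ ε)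
    (h₁₂ : |∑ θ ∈ B, q θ * ((θ.1 : ℝ) * θ.2)| ≤ ε) :
    barrier n x b δ c y ≤
      ∑ θ ∈ B, q θ * barrier n x b δ (c + 24 * (s + ε) / δ ^ 2 / znorm x ^ 2) (y + θ) := by
  have he := sum_mul_lin_mul_sq_le hn hb B hq hsum hsupp
  obtain ⟨hl, hd⟩ := hy
  have hlv : n.1 * ((y - x).1 : ℝ) + n.2 * ((y - x).2 : ℝ) = lin n y - lin n x := lin_sub n y x
  have hlR : lin n y ≤ 2 * znorm x := by
    have := (abs_le.1 (abs_lin_le hn y)).2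
    have := znorm_le_of_sub_le hd.le
    nlinarith
  have hbar : barrier n x b δ c y = c * (lin n y + lin n y ^ 2 / znorm x)
      - 6 / (δ * znorm x) ^ 2 * ((lin n y + b) * znorm (y - x) ^ 2) := by
    rw [barrier, div_pow]
    ring
  rw [sum_mul_barrier n x y b δ _ B hsum rfl rfl rfl rfl rfl rfl, hbar]
  exact barrier_drift_ineq hn hb hx hδ0 hδ hs hε hεs hxs hc hnx hl hlR hlv (znorm_sq _)
    (pow_le_pow_left₀ (znorm_nonneg _) hd.le 2) hμ h₁₁ h₂₂ h₁₂ he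

/-- The event that the walk starts at `x` and stays in `D` up to time `t`. -/
def stayEvent {Ω : Type*} (ξ : ℕ → Ω → ℤ × ℤ) (D : Set (ℤ × ℤ)) (x : ℤ × ℤ) (t : ℕ) : Set Ω :=
  {ω | ξ 0 ω = x ∧ ∀ s ≤ t, ξ s ω ∈ D}

section stay

variable {Ω : Type*} {ξ : ℕ → Ω → ℤ × ℤ}

lemma measurableSet_stayEvent (D : Set (ℤ × ℤ)) (x : ℤ × ℤ) (t : ℕ) :
    MeasurableSet[⨆ s ∈ Finset.range (t + 1), MeasurableSpace.comap (ξ s) ⊤]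
      (stayEvent ξ D x t) := by
  have hpre : ∀ s ≤ t, ∀ U : Set (ℤ × ℤ),
      MeasurableSet[⨆ s ∈ Finset.range (t + 1), MeasurableSpace.comap (ξ s) ⊤]
        (ξ s ⁻¹' U) := fun s hs U =>
    le_iSup₂_of_le (f := fun s (_ : s ∈ Finset.range (t + 1)) => MeasurableSpace.comap (ξ s) ⊤)
      s (Finset.mem_range.2 (Nat.lt_succ_of_le hs)) le_rfl _ ⟨U, trivial, rfl⟩
  have heq : stayEvent ξ D x t =
      ξ 0 ⁻¹' {x} ∩ ⋂ s ∈ Set.Iic t, ξ s ⁻¹' D := by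
    ext ω; simp [stayEvent]
  rw [heq]
  exact (hpre 0 (Nat.zero_le t) _).inter
    (MeasurableSet.biInter (Set.to_countable _) fun s hs => hpre s hs D)

lemma measurableSet_stayEvent' [MeasurableSpace Ω] (hmeas : ∀ t, Measurable (ξ t))
    (D : Set (ℤ × ℤ)) (x : ℤ × ℤ) (t : ℕ) : MeasurableSet (stayEvent ξ D x t) := by
  refine (iSup₂_le fun s _ => ?_ :
    (⨆ s ∈ Finset.range (t + 1), MeasurableSpace.comap (ξ s) ⊤) ≤ _) _
    (measurableSet_stayEvent D x t)
  rintro _ ⟨U, -, rfl⟩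
  exact hmeas s (Set.to_countable U).measurableSet

lemma lt_exitTime_of_stay {W : Set (ℤ × ℤ)} {t : ℕ} {r : ℝ} {ω : Ω} (hr : r < t + 1)
    (h : ∀ s ≤ t, ξ s ω ∈ W) : ENNReal.ofReal r < exitTime W ξ ω := by
  have h1 : ((t + 1 : ℕ) : ℝ≥0∞) ≤ exitTime W ξ ω := by
    refine le_iInf₂ fun s hs => ?_
    have : t < s := by
      by_contra! hst
      exact hs (h s hst)
    exact_mod_cast this
  refine lt_of_lt_of_le ?_ h1
  rw [← ENNReal.ofReal_natCast, ENNReal.ofReal_lt_ofReal_iff (by positivity)]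
  exact_mod_cast hr

variable [MeasurableSpace Ω] {P : Measure Ω} [IsProbabilityMeasure P]
  {p : ℤ × ℤ → ℤ × ℤ → ℝ}

/-- Transition equation for the law of the walk killed upon leaving `D`. -/
lemma measureReal_stayEvent_succ (hmeas : ∀ t, Measurable (ξ t)) (hp : ∀ x y, 0 ≤ p x y)
    (hMarkov : IsMarkovWith P ξ p) (D : Finset (ℤ × ℤ)) (x : ℤ × ℤ) (t : ℕ) {z : ℤ × ℤ}
    (hz : z ∈ D) :
    P.real (stayEvent ξ D x (t + 1) ∩ {ω | ξ (t + 1) ω = z}) =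
      ∑ y ∈ D, p y (z - y) * P.real (stayEvent ξ D x t ∩ {ω | ξ t ω = y}) := by
  have hset : ∀ s (y : ℤ × ℤ), MeasurableSet {ω | ξ s ω = y} := fun s y =>
    hmeas s (MeasurableSet.singleton y)
  have heq : stayEvent ξ D x (t + 1) ∩ {ω | ξ (t + 1) ω = z} =
      ⋃ y ∈ D, stayEvent ξ D x t ∩ {ω | ξ t ω = y} ∩ {ω | ξ (t + 1) ω = y + (z - y)} := by
    ext ω
    simp only [stayEvent, Set.mem_inter_iff, Set.mem_ofPred_eq, Set.mem_iUnion,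
      add_sub_cancel, exists_prop, Finset.mem_coe]
    constructor
    · rintro ⟨⟨h0, h⟩, h1⟩
      exact ⟨ξ t ω, h t (Nat.le_succ t), ⟨⟨h0, fun s hs => h s (hs.trans (Nat.le_succ t))⟩, rfl⟩,
        h1⟩
    · rintro ⟨y, -, ⟨⟨h0, h⟩, -⟩, h1⟩
      refine ⟨⟨h0, fun s hs => ?_⟩, h1⟩
      rcases Nat.le_succ_iff.1 hs with h' | rfl
      · exact h s h'
      · rw [h1]; exact hz
  rw [heq, measureReal_biUnion_finset]
  · refine Finset.sum_congr rfl fun y _ => ?_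
    rw [Measure.real, hMarkov t y (z - y) _ (measurableSet_stayEvent (D : Set (ℤ × ℤ)) x t),
      ENNReal.toReal_mul, ENNReal.toReal_ofReal (hp _ _), Measure.real]
  · intro y _ y' _ hne
    refine Set.disjoint_left.2 fun ω h h' => hne ?_
    exact h.1.2.symm.trans h'.1.2
  · exact fun y _ => ((measurableSet_stayEvent' hmeas _ x t).inter (hset t y)).inter (hset _ _)

lemma sum_kernel_ge {D B : Finset (ℤ × ℤ)} {q f : ℤ × ℤ → ℝ} {y : ℤ × ℤ}
    (hq : ∀ θ, 0 ≤ q θ) (hB : ∀ θ, q θ ≠ 0 → θ ∈ B)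
    (hexit : ∀ θ, q θ ≠ 0 → y + θ ∉ D → f (y + θ) ≤ 0) :
    ∑ θ ∈ B, q θ * f (y + θ) ≤ ∑ z ∈ D, q (z - y) * f z := by
  classical
  calc ∑ θ ∈ B, q θ * f (y + θ)
      ≤ ∑ θ ∈ B, if y + θ ∈ D then q θ * f (y + θ) else 0 := by
        refine Finset.sum_le_sum fun θ _ => ?_
        split_ifs with h
        · exact le_rfl
        · by_cases h0 : q θ = 0
          · simp [h0]
          · exact mul_nonpos_of_nonneg_of_nonpos (hq θ) (hexit θ h0 h)
    _ = ∑ z ∈ D, q (z - y) * f z := by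
        rw [← Finset.sum_filter]
        refine Finset.sum_bij_ne_zero (fun θ _ _ => y + θ) ?_ ?_ ?_ ?_
        · exact fun θ h _ => (Finset.mem_filter.1 h).2
        · exact fun θ _ _ θ' _ _ h => add_left_cancel h
        · intro z hz h0
          have h1 := hB _ (left_ne_zero_of_mul h0)
          exact ⟨z - y, Finset.mem_filter.2 ⟨h1, by rwa [add_sub_cancel]⟩,
            by rwa [add_sub_cancel], add_sub_cancel y z⟩
        · intro θ _ _
          rw [add_sub_cancel_left]

/-- A submartingale-type inequality up to the first exit from a finite set `D`, for a function
which is nonpositive at the exit position. -/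
lemma initial_le_sum_stayEvent (hmeas : ∀ t, Measurable (ξ t)) (hp : ∀ x y, 0 ≤ p x y)
    (hMarkov : IsMarkovWith P ξ p) {S : Set (ℤ × ℤ)} (hinS : ∀ t, ∀ᵐ ω ∂P, ξ t ω ∈ S)
    {D B : Finset (ℤ × ℤ)} {x : ℤ × ℤ} (hx : x ∈ D) (hB : ∀ y θ, p y θ ≠ 0 → θ ∈ B)
    {g : ℕ → ℤ × ℤ → ℝ} {T : ℕ}
    (hexit : ∀ t < T, ∀ y ∈ D, ∀ θ, p y θ ≠ 0 → y + θ ∉ D → g (t + 1) (y + θ) ≤ 0)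
    (hdrift : ∀ t < T, ∀ y ∈ D, y ∈ S → g t y ≤ ∑ θ ∈ B, p y θ * g (t + 1) (y + θ)) :
    g 0 x * P.real {ω | ξ 0 ω = x} ≤
      ∑ y ∈ D, g T y * P.real (stayEvent ξ D x T ∩ {ω | ξ T ω = y}) := by
  induction T with
  | zero =>
    rw [Finset.sum_eq_single_of_mem x hx]
    · refine le_of_eq ?_
      congr 2
      ext ω
      simp only [stayEvent, Set.mem_ofPred_eq, Set.mem_inter_iff, Nat.le_zero, forall_eq]
      exact ⟨fun h => ⟨⟨h, by rw [h]; exact hx⟩, h⟩, fun h => h.2⟩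
    · intro y _ hne
      have : stayEvent ξ D x 0 ∩ {ω | ξ 0 ω = y} = ∅ := by
        ext ω
        simp only [stayEvent, Set.mem_inter_iff, Set.mem_ofPred_eq, Set.mem_empty_iff_false,
          iff_false, not_and]
        exact fun h h' => hne (h'.symm.trans h.1)
      simp [this]
  | succ T ih =>
    refine (ih (fun t ht => hexit t (ht.trans T.lt_succ_self))
      (fun t ht => hdrift t (ht.trans T.lt_succ_self))).trans ?_
    calc ∑ y ∈ D, g T y * P.real (stayEvent ξ D x T ∩ {ω | ξ T ω = y})
        ≤ ∑ y ∈ D, (∑ z ∈ D, p y (z - y) * g (T + 1) z) *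
            P.real (stayEvent ξ D x T ∩ {ω | ξ T ω = y}) := by
          refine Finset.sum_le_sum fun y hy => ?_
          by_cases hyS : y ∈ S
          · exact mul_le_mul_of_nonneg_right ((hdrift T T.lt_succ_self y hy hyS).trans
              (sum_kernel_ge (hp y) (hB y) (hexit T T.lt_succ_self y hy))) measureReal_nonneg
          · have h0 : P {ω | ξ T ω = y} = 0 :=
              measure_mono_null (fun ω hω hS => hyS (hω ▸ hS)) (hinS T)
            have : P.real (stayEvent ξ D x T ∩ {ω | ξ T ω = y}) = 0 := by
              rw [Measure.real, measure_mono_null Set.inter_subset_right h0, ENNReal.toReal_zero]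
            simp [this]
      _ = ∑ z ∈ D, g (T + 1) z * P.real (stayEvent ξ D x (T + 1) ∩ {ω | ξ (T + 1) ω = z}) := by
          simp only [Finset.sum_mul]
          rw [Finset.sum_comm]
          refine Finset.sum_congr rfl fun z hz => ?_
          rw [measureReal_stayEvent_succ hmeas hp hMarkov D x T hz, Finset.mul_sum]
          exact Finset.sum_congr rfl fun y _ => by ring

lemma sum_measureReal_stayEvent (hmeas : ∀ t, Measurable (ξ t)) (D : Finset (ℤ × ℤ))
    (x : ℤ × ℤ) (t : ℕ) :
    ∑ y ∈ D, P.real (stayEvent ξ D x t ∩ {ω | ξ t ω = y}) = P.real (stayEvent ξ D x t) := by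
  rw [← measureReal_biUnion_finset]
  · congr 1
    ext ω
    simp only [Set.mem_iUnion, Set.mem_inter_iff, Set.mem_ofPred_eq, exists_prop]
    exact ⟨fun ⟨_, _, h, _⟩ => h, fun h => ⟨_, h.2 t le_rfl, h, rfl⟩⟩
  · intro y _ y' _ hne
    exact Set.disjoint_left.2 fun ω h h' => hne (h.2.symm.trans h'.2)
  · exact fun y _ => (measurableSet_stayEvent' hmeas _ x t).inter
      (hmeas t (MeasurableSet.singleton y))

end stay

section wedge

open Complex

/-- Half-planes adapted to a wedge, at a point in its upper half. -/
lemma exists_halfPlane_of_arg_nonneg {α η : ℝ} (hα0 : 0 < α) (hαπ : α ≤ Real.pi)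
    (hη : η ≤ α / 4) {z : ℂ} (hz : z ≠ 0) (h0 : 0 ≤ arg z) (hlt : arg z < α) :
    ∃ n : ℝ × ℝ, n.1 ^ 2 + n.2 ^ 2 = 1 ∧ 0 < n.1 * z.re + n.2 * z.im ∧
      Real.cos (Real.pi / (2 * α) * arg z) * ‖z‖ ≤
        (1 + Real.pi / (2 * α) * (Real.pi / 2)) * (n.1 * z.re + n.2 * z.im) ∧
      ∀ u : ℂ, u ≠ 0 → |arg u| < η → 0 < n.1 * (z * u).re + n.2 * (z * u).im →
        |arg (z * u)| < α := by
  have hπ := Real.pi_pos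
  have hzn : 0 < ‖z‖ := norm_pos_iff.2 hz
  set w := Real.pi / (2 * α) with hw
  have hw0 : 0 < w := by positivity
  rcases lt_or_ge (arg z) (α / 2) with hd | hd
  · refine ⟨(Real.cos (arg z), Real.sin (arg z)), Real.cos_sq_add_sin_sq _, ?_⟩
    have hval : Real.cos (arg z) * z.re + Real.sin (arg z) * z.im = ‖z‖ := by
      rw [← norm_mul_cos_arg z, ← norm_mul_sin_arg z]
      linear_combination ‖z‖ * Real.cos_sq_add_sin_sq (arg z)
    simp only [hval]
    refine ⟨hzn, ?_, fun u hu hau _ => ?_⟩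
    · have := Real.cos_le_one (w * arg z)
      have h2 : 0 ≤ w * (Real.pi / 2) := by positivity
      exact mul_le_mul_of_nonneg_right (by linarith) hzn.le
    · rw [abs_lt] at hau
      rw [Complex.arg_mul hz hu ⟨by linarith, by linarith⟩, abs_lt]
      constructor <;> linarith
  · have hval : ∀ v : ℂ, Real.sin α * v.re + -Real.cos α * v.im =
        ‖v‖ * Real.sin (α - arg v) := fun v => by
      rw [← norm_mul_cos_arg v, ← norm_mul_sin_arg v, Real.sin_sub]
      ring
    refine ⟨(Real.sin α, -Real.cos α), by simp, ?_⟩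
    simp only [hval]
    have hs : 0 < Real.sin (α - arg z) :=
      Real.sin_pos_of_pos_of_lt_pi (by linarith) (by linarith)
    refine ⟨by positivity, ?_, fun u hu hau hpos => ?_⟩
    · have h1 : Real.cos (w * arg z) ≤ w * (α - arg z) := by
        have e : w * arg z = Real.pi / 2 - w * (α - arg z) := by
          rw [hw]; field_simp; ring
        rw [e, Real.cos_pi_div_two_sub]
        exact Real.sin_le (mul_nonneg hw0.le (by linarith))
      have h2 := Real.mul_le_sin (x := α - arg z) (by linarith) (by linarith)
      have h3 : α - arg z ≤ Real.pi / 2 * Real.sin (α - arg z) := by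
        rw [div_mul_eq_mul_div, div_le_iff₀ hπ] at h2
        linarith
      have h4 := mul_le_mul_of_nonneg_left h3 hw0.le
      have h5 : Real.cos (w * arg z) ≤
          (1 + w * (Real.pi / 2)) * Real.sin (α - arg z) := by linarith
      calc _ ≤ _ := mul_le_mul_of_nonneg_right h5 hzn.le
        _ = _ := by ring
    · rw [abs_lt] at hau
      have hn : ‖z * u‖ * Real.sin (α - arg (z * u)) =
          ‖z * u‖ * Real.sin (α - (arg z + arg u)) := by
        rw [← hval, ← norm_mul_cos_arg, ← norm_mul_sin_arg, Real.sin_sub]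
        have hcos : Real.cos (arg (z * u)) = Real.cos (arg z + arg u) := by
          rw [← Real.Angle.cos_coe, arg_mul_coe_angle hz hu, ← Real.Angle.coe_add,
            Real.Angle.cos_coe]
        have hsin : Real.sin (arg (z * u)) = Real.sin (arg z + arg u) := by
          rw [← Real.Angle.sin_coe, arg_mul_coe_angle hz hu, ← Real.Angle.coe_add,
            Real.Angle.sin_coe]
        rw [hcos, hsin]
        ring
      rw [hn] at hpos
      have hlt' : arg z + arg u < α := by
        by_contra! hge
        have := Real.sin_nonpos_of_nonpos_of_neg_pi_le (x := α - (arg z + arg u))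
          (by linarith) (by linarith)
        have hzu := norm_nonneg (z * u)
        nlinarith
      rw [Complex.arg_mul hz hu ⟨by linarith, by linarith⟩, abs_lt]
      constructor <;> linarith

lemma exists_halfPlane {α : ℝ} (hα0 : 0 < α) (hαπ : α ≤ Real.pi) {z : ℂ} (hz : z ≠ 0)
    (hlt : |arg z| < α) :
    ∃ n : ℝ × ℝ, n.1 ^ 2 + n.2 ^ 2 = 1 ∧ 0 < n.1 * z.re + n.2 * z.im ∧
      Real.cos (Real.pi / (2 * α) * arg z) * ‖z‖ ≤
        (1 + Real.pi / (2 * α) * (Real.pi / 2)) * (n.1 * z.re + n.2 * z.im) ∧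
      ∀ u : ℂ, u ≠ 0 → |arg u| < α / 4 → 0 < n.1 * (z * u).re + n.2 * (z * u).im →
        |arg (z * u)| < α := by
  rcases le_or_gt 0 (arg z) with h0 | h0
  · exact exists_halfPlane_of_arg_nonneg hα0 hαπ le_rfl hz h0 ((le_abs_self _).trans_lt hlt)
  · have hconj : ∀ v : ℂ, |arg v| < α → arg ((starRingEnd ℂ) v) = -arg v := fun v hv => by
      rw [arg_conj, if_neg]
      intro h
      rw [h] at hv
      exact absurd ((le_abs_self _).trans_lt hv) (not_lt.2 hαπ)
    have hcz := hconj z hlt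
    obtain ⟨n, hn, hpos, hcos, hu⟩ := exists_halfPlane_of_arg_nonneg hα0 hαπ le_rfl
      (z := (starRingEnd ℂ) z) (by simpa using hz) (by rw [hcz]; linarith)
      (by rw [hcz]; exact (neg_le_abs _).trans_lt hlt)
    simp only [hcz, conj_re, conj_im, norm_conj, mul_neg, Real.cos_neg] at hpos hcos
    refine ⟨(n.1, -n.2), by simpa using hn, by simpa using hpos, by simpa using hcos, ?_⟩
    intro u hu0 hau hp
    have hcu := hconj u (hau.trans (by linarith))
    have h1 := hu ((starRingEnd ℂ) u) (by simpa using hu0) (by rwa [hcu, abs_neg])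
      (by rw [← map_mul, conj_re, conj_im]; linarith)
    rw [← map_mul] at h1
    have h2 := hconj _ h1
    rw [conj_conj] at h2
    rwa [h2, abs_neg]

end wedge

/-- Every point of the wedge has a half-ball inside the wedge, of radius proportional to its norm,
whose flat side is at least comparably as far away as the side of the wedge. -/
lemma exists_halfBall_subset {α : ℝ} (hα0 : 0 < α) (hαπ : α ≤ Real.pi) :
    ∃ δ : ℝ, 0 < δ ∧ δ ≤ 1 / 2 ∧ ∀ x ∈ WsetArg α, ∃ n : ℝ × ℝ, n.1 ^ 2 + n.2 ^ 2 = 1 ∧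
      0 < lin n x ∧
      Real.cos (Real.pi / (2 * α) * ang x) * znorm x ≤
        (1 + Real.pi / (2 * α) * (Real.pi / 2)) * lin n x ∧
      halfBall n x δ ⊆ WsetArg α := by
  have hcont : ContinuousAt Complex.arg 1 := Complex.continuousAt_arg Complex.one_mem_slitPlane
  obtain ⟨δ, hδ, hδarg⟩ := Metric.continuousAt_iff.1 hcont (α / 4) (by positivity)
  refine ⟨min δ (1 / 2), by positivity, min_le_right _ _, fun x hx => ?_⟩
  obtain ⟨hx0, hxl, hxr⟩ := hx
  rw [znorm_eq_norm] at hx0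
  obtain ⟨n, hn, hpos, hcos, hu⟩ := exists_halfPlane hα0 hαπ (norm_pos_iff.1 hx0)
    (abs_lt.2 ⟨hxl, hxr⟩)
  refine ⟨n, hn, hpos, ?_, fun y hy => ?_⟩
  · rw [znorm_eq_norm]; exact hcos
  obtain ⟨hyl, hyd⟩ := hy
  set z : ℂ := ⟨x.1, x.2⟩ with hz
  have hz0 : z ≠ 0 := norm_pos_iff.1 hx0
  have hyz : (⟨y.1, y.2⟩ : ℂ) = z * (⟨y.1, y.2⟩ / z) := (mul_div_cancel₀ _ hz0).symm
  set u : ℂ := ⟨y.1, y.2⟩ / z with hu'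
  have hdist : ‖u - 1‖ < min δ (1 / 2) := by
    have h1 : znorm (y - x) = ‖z‖ * ‖u - 1‖ := by
      rw [← norm_mul, mul_sub, ← hyz, mul_one, znorm_eq_norm]
      congr 1
      apply Complex.ext <;> simp [hz]
    rw [h1, znorm_eq_norm, mul_comm] at hyd
    exact lt_of_mul_lt_mul_right hyd hx0.le
  have hu0 : u ≠ 0 := by
    intro h
    rw [h, zero_sub, norm_neg, norm_one] at hdist
    exact absurd (hdist.trans_le (min_le_right _ _)) (by norm_num)
  have hau : |Complex.arg u| < α / 4 := by
    have := hδarg (x := u) (by rw [dist_eq_norm]; exact hdist.trans_le (min_le_left _ _))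
    rwa [Complex.arg_one, dist_zero_right, Real.norm_eq_abs] at this
  have hy := hu u hu0 hau (by rw [← hyz]; exact hyl)
  rw [← hyz, abs_lt] at hy
  refine ⟨?_, hy.1, hy.2⟩
  rw [znorm_eq_norm, hyz]
  exact norm_pos_iff.2 (mul_ne_zero hz0 hu0)

lemma lt_znorm_of_mem_halfBall {n : ℝ × ℝ} {x y : ℤ × ℤ} {δ : ℝ} (hδ : δ ≤ 1 / 2)
    (hy : y ∈ halfBall n x δ) : znorm x / 2 < znorm y := by
  have h1 := hy.2
  rw [znorm_sub_comm] at h1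
  have h2 := znorm_le_of_sub_le le_rfl (x := y) (y := x)
  nlinarith [znorm_nonneg x]

/-- A lower bound for the probability of staying in a half-ball for a time of order `‖x‖²`. -/
lemma lin_mul_le_stayEvent {Ω : Type*} [MeasurableSpace Ω] {P : Measure Ω}
    [IsProbabilityMeasure P] {S : Set (ℤ × ℤ)} {ξ : ℕ → Ω → ℤ × ℤ}
    (hmeas : ∀ t, Measurable (ξ t)) (hinS : ∀ t, ∀ᵐ ω ∂P, ξ t ω ∈ S)
    {p : ℤ × ℤ → ℤ × ℤ → ℝ} (hpmf : IsJumpPMF p) (hMarkov : IsMarkovWith P ξ p)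
    {b : ℝ} (hb : 0 < b) (hA2 : A2 p b) {n : ℝ × ℝ} (hn : n.1 ^ 2 + n.2 ^ 2 = 1)
    {x : ℤ × ℤ} {δ s ε : ℝ} (hbx : 2 * b ≤ znorm x) (hδ0 : 0 < δ) (hδ : δ ≤ 1 / 2)
    (hs : 0 < s) (hε : 0 < ε) (hεs : 24 * ε + 48 * ε / δ ≤ s / 2)
    (hxs : 6 / δ ^ 2 * (b * (2 * s + 4 * ε) + b ^ 3) ≤ s / 2 * znorm x)
    (hnx : 0 < lin n x)
    (hmom : ∀ y ∈ S, znorm x / 2 ≤ znorm y →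
      znorm y * muNorm p y ≤ ε ∧ |M11 p y - s| ≤ ε ∧ |M22 p y - s| ≤ ε ∧ |M12 p y| ≤ ε)
    {T : ℕ} (hT : 24 * (s + ε) / δ ^ 2 / znorm x ^ 2 * T ≤ 1) :
    lin n x * P.real {ω | ξ 0 ω = x} ≤
      12 * znorm x * P.real (stayEvent ξ (halfBall n x δ) x T) := by
  have hR : 0 < znorm x := by linarith
  set γ := 24 * (s + ε) / δ ^ 2 / znorm x ^ 2 with hγ
  have hγ0 : 0 ≤ γ := by positivity
  set D := (finite_halfBall n x δ).toFinset with hD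
  have hDmem : ∀ y, y ∈ D ↔ y ∈ halfBall n x δ := fun y => Set.Finite.mem_toFinset _
  have hDcoe : (D : Set (ℤ × ℤ)) = halfBall n x δ := Set.Finite.coe_toFinset _
  set B := (finite_znorm_le b).toFinset with hBdef
  have hB : ∀ y θ, p y θ ≠ 0 → znorm θ ≤ b := fun y θ h => by
    by_contra! hlt
    exact h (hA2 y θ hlt)
  have hBmem : ∀ y θ, p y θ ≠ 0 → θ ∈ B := fun y θ h =>
    (Set.Finite.mem_toFinset _).2 (hB y θ h)
  have htsum : ∀ y (f : ℤ × ℤ → ℝ), ∑' θ, p y θ * f θ = ∑ θ ∈ B, p y θ * f θ := fun y f =>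
    tsum_eq_sum fun θ hθ => by
      rw [not_imp_comm.1 (hBmem y θ) hθ, zero_mul]
  have hsum : ∀ y, ∑ θ ∈ B, p y θ = 1 := fun y => by
    rw [← (hpmf.2 y).tsum_eq]
    exact (tsum_eq_sum fun θ hθ => not_imp_comm.1 (hBmem y θ) hθ).symm
  have hc : ∀ t ≤ T, 1 + γ * (t : ℝ) ≤ 2 := fun t ht => by
    have : γ * (t : ℝ) ≤ γ * T := mul_le_mul_of_nonneg_left (by exact_mod_cast ht) hγ0
    linarith
  have hc1 : ∀ t : ℕ, 1 ≤ 1 + γ * (t : ℝ) := fun t => by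
    have : 0 ≤ γ * (t : ℝ) := by positivity
    linarith
  have hxD : x ∈ D := (hDmem x).2 ⟨hnx, by
    have : znorm (x - x) = 0 := by simp [znorm]
    rw [this]; positivity⟩
  have key := initial_le_sum_stayEvent (P := P) (T := T)
    (g := fun t => barrier n x b δ (1 + γ * (t : ℝ)))
    hmeas hpmf.1 hMarkov hinS hxD hBmem
    (fun t ht y hy θ hθ hout => barrier_nonpos_of_exit hn hb hbx hδ0 hδ
      (zero_le_one.trans (hc1 _)) (hc (t + 1) ht) ((hDmem y).1 hy) (hB y θ hθ)
      (fun h => hout ((hDmem _).2 h)))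
    (fun t _ y hy hyS => by
      have hyD := (hDmem y).1 hy
      have hyR := (lt_znorm_of_mem_halfBall hδ hyD).le
      obtain ⟨hμ, h11, h22, h12⟩ := hmom y hyS hyR
      have hμ0 : 0 ≤ muNorm p y := Real.sqrt_nonneg _
      have hμ' : muNorm p y ≤ 2 * ε / znorm x := by
        rw [le_div_iff₀ hR]
        nlinarith
      have hμsq : mu1 p y ^ 2 + mu2 p y ^ 2 ≤ (2 * ε / znorm x) ^ 2 := by
        rw [← Real.sq_sqrt (by positivity : 0 ≤ mu1 p y ^ 2 + mu2 p y ^ 2)]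
        exact pow_le_pow_left₀ hμ0 hμ' 2
      rw [M11, htsum] at h11
      rw [M22, htsum] at h22
      rw [M12, htsum] at h12
      rw [mu1, mu2, htsum, htsum] at hμsq
      have := barrier_le_sum hn hb hR hδ0 hδ hs hε hεs hxs (hc1 t) hnx hyD B (hpmf.1 y) (hsum y)
        (hA2 y) hμsq h11 h22 h12
      have e : 1 + γ * ((t + 1 : ℕ) : ℝ) = 1 + γ * (t : ℝ) + γ := by push_cast; ring
      simp only [e]
      exact this)
  simp only [Nat.cast_zero, mul_zero, add_zero] at key
  calc lin n x * P.real {ω | ξ 0 ω = x}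
      ≤ barrier n x b δ 1 x * P.real {ω | ξ 0 ω = x} :=
        mul_le_mul_of_nonneg_right (le_barrier_self n x b δ) measureReal_nonneg
    _ ≤ _ := key
    _ ≤ ∑ y ∈ D, 12 * znorm x * P.real (stayEvent ξ D x T ∩ {ω | ξ T ω = y}) :=
        Finset.sum_le_sum fun y hy => mul_le_mul_of_nonneg_right
          (barrier_le hn hR hb hδ (zero_le_one.trans (hc1 T)) (hc T le_rfl) ((hDmem y).1 hy))
          measureReal_nonneg
    _ = 12 * znorm x * P.real (stayEvent ξ (halfBall n x δ) x T) := by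
        rw [← Finset.mul_sum, sum_measureReal_stayEvent hmeas D x T, hDcoe]

/-- Lemma 5.5: under (A1), (A2) and (sub2), for `α ∈ (0,π]` and
`w = π/(2α)`, there are `A ∈ (0,∞)` and `ε₁, ε₂ > 0` such that for all `x ∈ W(α)`
with `‖x‖ > A`, `P[τ_{α,A} > ε₁‖x‖² ∣ ξ₀ = x] ≥ ε₂ cos(wφ(x))`. -/
theorem exit_time_lower_tail_bound
    {Ω : Type*} [MeasurableSpace Ω] (P : Measure Ω) [IsProbabilityMeasure P]
    (S : Set (ℤ × ℤ)) (hSunb : ∀ R : ℝ, ∃ x ∈ S, R < znorm x)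
    (ξ : ℕ → Ω → ℤ × ℤ) (hmeas : ∀ t, Measurable (ξ t))
    (hinS : ∀ t, ∀ᵐ ω ∂P, ξ t ω ∈ S)
    (p : ℤ × ℤ → ℤ × ℤ → ℝ) (hpmf : IsJumpPMF p)
    (hMarkov : IsMarkovWith P ξ p)
    (κ : ℝ) (k n₀ : ℕ) (hκ : 0 < κ) (hk : 0 < k) (hn₀ : 0 < n₀)
    (hA1 : A1 P S ξ κ k n₀)
    (b : ℝ) (hb : 0 < b) (hA2 : A2 p b)
    (σ2 : ℝ) (hσ : 0 < σ2)
    (hsub2 : ∀ ε : ℝ, 0 < ε → ∃ r₁ : ℝ, ∀ x ∈ S, r₁ ≤ znorm x →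
      znorm x * muNorm p x ≤ ε ∧ |M11 p x - σ2| ≤ ε ∧ |M22 p x - σ2| ≤ ε ∧ |M12 p x| ≤ ε)
    (α w : ℝ) (hα0 : 0 < α) (hαπ : α ≤ Real.pi) (hw : w = Real.pi / (2 * α)) :
    ∃ A ε₁ ε₂ : ℝ, 0 < A ∧ 0 < ε₁ ∧ 0 < ε₂ ∧
      ∀ x ∈ WsetArg α, A < znorm x →
        ENNReal.ofReal (ε₂ * Real.cos (w * ang x)) * P {ω | ξ 0 ω = x} ≤
          P ({ω | ENNReal.ofReal (ε₁ * znorm x ^ 2) <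
                exitTime {z ∈ WsetArg α | A < znorm z} ξ ω} ∩
            {ω | ξ 0 ω = x}) := by
  obtain ⟨δ, hδ0, hδ, hgeom⟩ := exists_halfBall_subset hα0 hαπ
  set ε := δ * σ2 / 144 with hεdef
  have hε : 0 < ε := by positivity
  have hεs : 24 * ε + 48 * ε / δ ≤ σ2 / 2 := by
    have h1 : 48 * ε / δ = σ2 / 3 := by rw [hεdef]; field_simp; norm_num
    have h2 : δ * σ2 ≤ 1 / 2 * σ2 := mul_le_mul_of_nonneg_right hδ hσ.le
    rw [h1]
    linarith
  obtain ⟨r₁, hr₁⟩ := hsub2 ε hε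
  set L := 2 / σ2 * (6 / δ ^ 2 * (b * (2 * σ2 + 4 * ε) + b ^ 3)) with hL
  set A := max (max 1 b) (max r₁ L) with hA
  have hA1' : 1 ≤ A := (le_max_left _ _).trans (le_max_left _ _)
  have hAb : b ≤ A := (le_max_right _ _).trans (le_max_left _ _)
  have hAr : r₁ ≤ A := (le_max_left _ _).trans (le_max_right _ _)
  have hAL : L ≤ A := (le_max_right _ _).trans (le_max_right _ _)
  have hA0 : 0 < A := by linarith
  set γ := 24 * (σ2 + ε) / δ ^ 2 with hγ
  have hγ0 : 0 < γ := by positivity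
  set K := 1 + Real.pi / (2 * α) * (Real.pi / 2) with hK
  have hK1 : 1 ≤ K := by
    have : 0 ≤ Real.pi / (2 * α) * (Real.pi / 2) := by positivity
    linarith
  refine ⟨A, min (1 / γ) (1 / (4 * A ^ 2)), 1 / (12 * K), hA0, by positivity, by positivity,
    fun x hxW hxA => ?_⟩
  set ε₁ := min (1 / γ) (1 / (4 * A ^ 2)) with hε₁
  have hε₁0 : 0 < ε₁ := by positivity
  have hR : 0 < znorm x := hA0.trans hxA
  rcases lt_or_ge (znorm x) (2 * A) with hsmall | hlarge
  · have hone : ε₁ * znorm x ^ 2 < (0 : ℕ) + 1 := by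
      have h1 : ε₁ ≤ 1 / (4 * A ^ 2) := min_le_right _ _
      rw [le_div_iff₀ (by positivity)] at h1
      have h2 : znorm x ^ 2 < 4 * A ^ 2 := by nlinarith
      have h3 := mul_lt_mul_of_pos_left h2 hε₁0
      push_cast
      linarith
    calc _ ≤ 1 * P {ω | ξ 0 ω = x} := by
          refine mul_le_mul_left ?_ _
          refine ENNReal.ofReal_le_one.2 ?_
          have h1 : 1 / (12 * K) ≤ 1 := by
            rw [div_le_one (by positivity)]; linarith
          exact (mul_le_of_le_one_right (by positivity) (Real.cos_le_one _)).trans h1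
      _ = P {ω | ξ 0 ω = x} := one_mul _
      _ ≤ _ := measure_mono fun ω hω => by
          have hω : ξ 0 ω = x := hω
          refine ⟨lt_exitTime_of_stay hone fun s hs => ?_, hω⟩
          rw [Nat.le_zero.1 hs, hω]
          exact ⟨hxW, hxA⟩
  · obtain ⟨n, hn, hnx, hcos, hsubset⟩ := hgeom x hxW
    rw [← hw] at hcos
    set T := ⌊ε₁ * znorm x ^ 2⌋₊ with hTdef
    have hT : γ / znorm x ^ 2 * T ≤ 1 := by
      have h1 : (T : ℝ) ≤ ε₁ * znorm x ^ 2 := Nat.floor_le (by positivity)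
      have h2 : ε₁ * γ ≤ 1 := by
        rw [← le_div_iff₀ hγ0]; exact min_le_left _ _
      rw [div_mul_eq_mul_div, div_le_one (by positivity)]
      calc γ * T ≤ γ * (ε₁ * znorm x ^ 2) := mul_le_mul_of_nonneg_left h1 hγ0.le
        _ = (ε₁ * γ) * znorm x ^ 2 := by ring
        _ ≤ 1 * znorm x ^ 2 := mul_le_mul_of_nonneg_right h2 (sq_nonneg _)
        _ = znorm x ^ 2 := one_mul _
    have hxs : 6 / δ ^ 2 * (b * (2 * σ2 + 4 * ε) + b ^ 3) ≤ σ2 / 2 * znorm x := by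
      have h1 : L ≤ znorm x := hAL.trans hxA.le
      have h2 := mul_le_mul_of_nonneg_left h1 (by positivity : 0 ≤ σ2 / 2)
      refine le_trans (le_of_eq ?_) h2
      rw [hL]
      field_simp
    have hstay := lin_mul_le_stayEvent (P := P) hmeas hinS hpmf hMarkov hb hA2 hn
      (by linarith) hδ0 hδ hσ hε hεs hxs hnx
      (fun y hyS hy => hr₁ y hyS (by linarith)) hT
    have hprob : 1 / (12 * K) * Real.cos (w * ang x) * P.real {ω | ξ 0 ω = x} ≤
        P.real (stayEvent ξ (halfBall n x δ) x T) := by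
      have h1 := mul_le_mul_of_nonneg_right hcos
        (measureReal_nonneg (μ := P) (s := {ω | ξ 0 ω = x}))
      have h2 := mul_le_mul_of_nonneg_left hstay (by linarith : 0 ≤ K)
      rw [div_mul_eq_mul_div, div_mul_eq_mul_div, div_le_iff₀ (by positivity)]
      refine le_of_mul_le_mul_right ?_ hR
      linarith
    calc _ = ENNReal.ofReal (1 / (12 * K) * Real.cos (w * ang x)) *
            ENNReal.ofReal (P.real {ω | ξ 0 ω = x}) := by rw [ofReal_measureReal]
      _ = ENNReal.ofReal (1 / (12 * K) * Real.cos (w * ang x) * P.real {ω | ξ 0 ω = x}) :=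
          (ENNReal.ofReal_mul' measureReal_nonneg).symm
      _ ≤ ENNReal.ofReal (P.real (stayEvent ξ (halfBall n x δ) x T)) :=
          ENNReal.ofReal_le_ofReal hprob
      _ = P (stayEvent ξ (halfBall n x δ) x T) := ofReal_measureReal
      _ ≤ _ := by
          exact measure_mono fun ω hω => ⟨lt_exitTime_of_stay (Nat.lt_floor_add_one _) fun s hs =>
            ⟨hsubset (hω.2 s hs), by
              have := lt_znorm_of_mem_halfBall hδ (hω.2 s hs)
              linarith⟩, hω.1⟩
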